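/- Let f be a cohesive set of distinct monomials of degree 2 in R generating the ideal I = (f). Then I is linearly presented (its first syzygy module is generated by linear syzygies) if and only if the edge graph L(f) of G(f) has diameter at most 2. -/

import Mathlib

noncomputable section

namespace PolarAlg

open MvPolynomial

variable (k : Type*) [Field k]

/-- The exponent vector of the degree-2 monomial attached to an edge (or loop) `e`. -/
def sym2Exp {n : ℕ} (e : Sym2 (Fin n)) : Fin n → ℕ :=
  Sym2.lift ⟨fun a b i => (if a = i then 1 else 0) + (if b = i then 1 else 0),
    fun a b => funext fun i => add_comm _ _⟩ e

/-- The monomial with exponent vector `g`. -/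
def mon {n : ℕ} (g : Fin n → ℕ) : MvPolynomial (Fin n) k := ∏ i, X i ^ g i

/-- The degree-2 monomial `f i` attached to the edge `ε i` of the graph of `f`. -/
def fmon {n : ℕ} {ι : Type*} (ε : ι → Sym2 (Fin n)) (i : ι) : MvPolynomial (Fin n) k :=
  mon k (sym2Exp (ε i))

/-- `(vtx, eidx)` is an (even, of length `2r`) closed walk in the graph `G(f)` whose edges are
indexed by `ι` via `ε` : the `j`-th edge of the walk is the edge `ε (eidx j)`, joining
`vtx j` and `vtx (j+1)`. -/
def IsWalkIn {n r : ℕ} {ι : Type*} (ε : ι → Sym2 (Fin n)) (vtx : ZMod (2 * r) → Fin n)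
    (eidx : ZMod (2 * r) → ι) : Prop :=
  ∀ j, ε (eidx j) = s(vtx j, vtx (j + 1))

/-- The exponent vector of the lcm `g` of the (distinct) edge monomials of a walk. -/
def supExp {n r : ℕ} (vtx : ZMod (2 * r) → Fin n) : Fin n → ℕ := fun l =>
  (Finset.range (2 * r)).sup fun j =>
    sym2Exp (s(vtx (j : ZMod (2 * r)), vtx ((j : ZMod (2 * r)) + 1))) l

/-- The differential syzygy `z_w` attached to an even closed walk `w = (vtx, eidx)`:
its `i`-th coordinate is the sum of the alternating terms `± g/g_j` over the positions `j`
at which the walk traverses the edge `f i`. -/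
def zw {n r : ℕ} {ι : Type*} [DecidableEq ι] (ε : ι → Sym2 (Fin n))
    (vtx : ZMod (2 * r) → Fin n) (eidx : ZMod (2 * r) → ι) : ι → MvPolynomial (Fin n) k :=
  fun i => ∑ j ∈ Finset.range (2 * r),
    if eidx (j : ZMod (2 * r)) = i then
      (-1 : MvPolynomial (Fin n) k) ^ j * mon k fun l => supExp vtx l - sym2Exp (ε i) l
    else 0

/-- The binomial `p_w = T_{w⁺} - T_{w⁻}` attached to an even closed walk. -/
def pw {r : ℕ} {ι : Type*} (eidx : ZMod (2 * r) → ι) : MvPolynomial ι k :=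
  (∏ j ∈ (Finset.range (2 * r)).filter (fun j => Even j), X (eidx (j : ZMod (2 * r)))) -
    ∏ j ∈ (Finset.range (2 * r)).filter (fun j => ¬ Even j), X (eidx (j : ZMod (2 * r)))

/-- The differential syzygy module `Z` of `f`, as the set of syzygies of the transposed
Jacobian module: vectors `a` with `∑ i, a i · df i = 0`, i.e. `∑ i, a i ∂f i/∂x l = 0`
for every `l`. -/
def Zset (n : ℕ) {ι : Type*} [Fintype ι] (ε : ι → Sym2 (Fin n)) :
    Set (ι → MvPolynomial (Fin n) k) :=
  {a | ∀ l : Fin n, ∑ i, a i * pderiv l (fmon k ε i) = 0}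

/-- The generators of the polar syzygy module: the `T`-gradients of the polynomial
relations of `f`, evaluated at `f`. -/
def polarSet (n : ℕ) {ι : Type*} [Fintype ι] (ε : ι → Sym2 (Fin n)) :
    Set (ι → MvPolynomial (Fin n) k) :=
  {v | ∃ F : MvPolynomial ι k, aeval (fmon k ε) F = 0 ∧
    v = fun i => aeval (fmon k ε) (pderiv i F)}

/-- `f` is polarizable: the polar syzygy module `P` equals the differential syzygy module
`Z` (the inclusion `P ⊆ Z` always holds, by the chain rule). -/
def Polarizable (n : ℕ) {ι : Type*} [Fintype ι] (ε : ι → Sym2 (Fin n)) : Prop :=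
  Zset k n ε ⊆ ↑(Submodule.span (MvPolynomial (Fin n) k) (polarSet k n ε))

end PolarAlg

noncomputable section

namespace PolarAlg

open MvPolynomial

/-- The first syzygy module of the ideal `I = (f)`, as a set: vectors `a` with
`∑ i, a i · f i = 0`. -/
def SyzSet (k : Type*) [Field k] (n : ℕ) {ι : Type*} [Fintype ι]
    (ε : ι → Sym2 (Fin n)) : Set (ι → MvPolynomial (Fin n) k) :=
  {a | ∑ i, a i * fmon k ε i = 0}

/-- `I = (f)` is linearly presented: its first syzygy module is generated by the syzygies
all of whose entries are linear forms. -/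
def LinearlyPresented (k : Type*) [Field k] (n : ℕ) {ι : Type*} [Fintype ι]
    (ε : ι → Sym2 (Fin n)) : Prop :=
  SyzSet k n ε =
    ↑(Submodule.span (MvPolynomial (Fin n) k)
      {a ∈ SyzSet k n ε | ∀ i, a i = 0 ∨ (a i).IsHomogeneous 1})

/-- Adjacency in the edge graph `L(f)` of `G(f)`: two distinct edges of `G(f)` are adjacent
iff the corresponding monomials have a common variable (`gcd ≠ 1`). -/
def LAdj {n : ℕ} {ι : Type*} (ε : ι → Sym2 (Fin n)) (i j : ι) : Prop :=
  i ≠ j ∧ ∃ v : Fin n, v ∈ ε i ∧ v ∈ ε j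

/-- The edge graph `L(f)` has diameter at most 2. -/
def DiamLeTwo {n : ℕ} {ι : Type*} (ε : ι → Sym2 (Fin n)) : Prop :=
  ∀ i j : ι, i = j ∨ LAdj ε i j ∨ ∃ l, LAdj ε i l ∧ LAdj ε l j

end PolarAlg

namespace PolarAlg

open MvPolynomial

/-- The exponent vector of an edge as a finitely supported function. -/
def edgeExp {n : ℕ} (e : Sym2 (Fin n)) : Fin n →₀ ℕ :=
  Finsupp.equivFunOnFinite.symm (sym2Exp e)

theorem edgeExp_mk {n : ℕ} (a b i : Fin n) :
    edgeExp s(a, b) i = (if a = i then 1 else 0) + (if b = i then 1 else 0) := rfl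

theorem mem_iff_edgeExp_pos {n : ℕ} (e : Sym2 (Fin n)) (u : Fin n) :
    u ∈ e ↔ 0 < edgeExp e u := by
  induction e with
  | _ a b =>
    rw [edgeExp_mk, Sym2.mem_iff]
    split_ifs <;> simp_all [eq_comm]

theorem fmon_eq_monomial (k : Type*) [Field k] {n : ℕ} {ι : Type*} (ε : ι → Sym2 (Fin n))
    (i : ι) : fmon k ε i = monomial (edgeExp (ε i)) 1 := by
  rw [monomial_eq, C_1, one_mul, Finsupp.prod_fintype _ _ (fun _ => pow_zero _)]
  rfl

theorem monomial_edgeExp_mk (k : Type*) [Field k] {n : ℕ} (a b : Fin n) :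
    monomial (edgeExp s(a, b)) (1 : k) = X a * X b := by
  rw [X, X, monomial_mul, one_mul]
  congr 2
  ext i
  simp [edgeExp_mk, Finsupp.single_apply]

/-- The submodule generated by the linear syzygies. -/
def linearSyzygies (k : Type*) [Field k] (n : ℕ) {ι : Type*} [Fintype ι]
    (ε : ι → Sym2 (Fin n)) : Submodule (MvPolynomial (Fin n) k) (ι → MvPolynomial (Fin n) k) :=
  Submodule.span (MvPolynomial (Fin n) k)
    {a ∈ SyzSet k n ε | ∀ i, a i = 0 ∨ (a i).IsHomogeneous 1}

theorem linearSyzygies_subset_SyzSet (k : Type*) [Field k] {n : ℕ} {ι : Type*} [Fintype ι]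
    (ε : ι → Sym2 (Fin n)) : (linearSyzygies k n ε : Set _) ⊆ SyzSet k n ε := by
  intro a ha
  induction ha using Submodule.span_induction with
  | mem x hx => exact hx.1
  | zero => simp [SyzSet]
  | add x y _ _ hx hy =>
    simp only [SyzSet, Set.mem_ofPred_eq, Pi.add_apply, add_mul, Finset.sum_add_distrib] at *
    rw [hx, hy, add_zero]
  | smul r x _ hx =>
    simp only [SyzSet, Set.mem_ofPred_eq, Pi.smul_apply, smul_eq_mul, mul_assoc,
      ← Finset.mul_sum] at *
    rw [hx, mul_zero]

section

variable (k : Type*) [Field k] {n : ℕ} {ι : Type*} [Fintype ι] [DecidableEq ι]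
  (ε : ι → Sym2 (Fin n))

theorem single_sub_single_mem_SyzSet {i j : ι} {p q : MvPolynomial (Fin n) k}
    (h : p * fmon k ε i = q * fmon k ε j) :
    (Pi.single i p - Pi.single j q : ι → MvPolynomial (Fin n) k) ∈ SyzSet k n ε := by
  simp [SyzSet, sub_mul, Finset.sum_sub_distrib, Pi.single_apply, ite_mul, h]

theorem sub_mem_linearSyzygies_of_LAdj (hinj : Function.Injective ε) {i j : ι}
    (h : LAdj ε i j) {D : Fin n →₀ ℕ} (hi : edgeExp (ε i) ≤ D) (hj : edgeExp (ε j) ≤ D) :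
    (Pi.single i (monomial (D - edgeExp (ε i)) 1) -
      Pi.single j (monomial (D - edgeExp (ε j)) 1) : ι → MvPolynomial (Fin n) k) ∈
        linearSyzygies k n ε := by
  obtain ⟨hij, a, ⟨b, hb⟩, ⟨c, hc⟩⟩ := h
  have hbc : b ≠ c := by
    rintro rfl
    exact hij (hinj (hb.trans hc.symm))
  have hgen : (Pi.single i (X c) - Pi.single j (X b) : ι → MvPolynomial (Fin n) k) ∈
      linearSyzygies k n ε := by
    refine Submodule.subset_span ⟨single_sub_single_mem_SyzSet k ε ?_, fun l => Or.inr ?_⟩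
    · rw [fmon_eq_monomial, fmon_eq_monomial, hb, hc, monomial_edgeExp_mk, monomial_edgeExp_mk]
      ring
    · refine IsHomogeneous.sub ?_ ?_ <;> rw [Pi.single_apply] <;> split_ifs
      exacts [isHomogeneous_X _ _, isHomogeneous_zero _ _ _, isHomogeneous_X _ _,
        isHomogeneous_zero _ _ _]
  rw [hb] at hi ⊢
  rw [hc] at hj ⊢
  have hi' : D - edgeExp s(a, b) =
      D - edgeExp s(a, b) - Finsupp.single c 1 + Finsupp.single c 1 := by
    ext t
    have h1 := hi t
    have h2 := hj t
    simp only [Finsupp.add_apply, Finsupp.tsub_apply, edgeExp_mk, Finsupp.single_apply] at *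
    split_ifs at * <;> omega
  have hj' : D - edgeExp s(a, c) =
      D - edgeExp s(a, b) - Finsupp.single c 1 + Finsupp.single b 1 := by
    ext t
    have h1 := hi t
    have h2 := hj t
    simp only [Finsupp.add_apply, Finsupp.tsub_apply, edgeExp_mk, Finsupp.single_apply] at *
    split_ifs at * <;> omega
  have key := (linearSyzygies k n ε).smul_mem
    (monomial (D - edgeExp s(a, b) - Finsupp.single c 1) 1) hgen
  rw [smul_sub, ← Pi.single_smul, ← Pi.single_smul, smul_eq_mul, smul_eq_mul, X, X,
    monomial_mul, monomial_mul, one_mul] at key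
  rwa [← hi', ← hj'] at key

theorem sub_mem_linearSyzygies (hinj : Function.Injective ε) (hdiam : DiamLeTwo ε) (i j : ι)
    {D : Fin n →₀ ℕ} (hi : edgeExp (ε i) ≤ D) (hj : edgeExp (ε j) ≤ D) :
    (Pi.single i (monomial (D - edgeExp (ε i)) 1) -
      Pi.single j (monomial (D - edgeExp (ε j)) 1) : ι → MvPolynomial (Fin n) k) ∈
        linearSyzygies k n ε := by
  by_cases hij : i = j
  · subst hij
    simp
  by_cases hadj : LAdj ε i j
  · exact sub_mem_linearSyzygies_of_LAdj k ε hinj hadj hi hj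
  obtain h | h | ⟨l, hil, hlj⟩ := hdiam i j
  · exact absurd h hij
  · exact absurd h hadj
  have hdisj : ∀ v, v ∈ ε i → v ∉ ε j := fun v hv hv' => hadj ⟨hij, v, hv, hv'⟩
  have hl : edgeExp (ε l) ≤ D := by
    obtain ⟨-, a, hai, hal⟩ := hil
    obtain ⟨-, c, hcl, hcj⟩ := hlj
    have hac : a ≠ c := by
      rintro rfl
      exact hdisj a hai hcj
    rw [(Sym2.mem_and_mem_iff hac).1 ⟨hal, hcl⟩]
    intro t
    have ha := ((mem_iff_edgeExp_pos _ _).1 hai).trans_le (hi a)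
    have hc := ((mem_iff_edgeExp_pos _ _).1 hcj).trans_le (hj c)
    rw [edgeExp_mk]
    split_ifs with h1 h2 h2
    · exact absurd (h1.trans h2.symm) hac
    · exact h1 ▸ ha
    · exact h2 ▸ hc
    · exact Nat.zero_le _
  have := (linearSyzygies k n ε).add_mem (sub_mem_linearSyzygies_of_LAdj k ε hinj hil hi hl)
    (sub_mem_linearSyzygies_of_LAdj k ε hinj hlj hl hj)
  rwa [sub_add_sub_cancel] at this

theorem linearlyPresented_of_diamLeTwo (hinj : Function.Injective ε) (hdiam : DiamLeTwo ε) :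
    LinearlyPresented k n ε := by
  classical
  refine Set.Subset.antisymm (fun a ha => ?_) (linearSyzygies_subset_SyzSet k ε)
  change a ∈ linearSyzygies k n ε
  let φ : MvPolynomial (Fin n) k →ₗ[k]
      ((ι → MvPolynomial (Fin n) k) ⧸ linearSyzygies k n ε) :=
    (basisMonomials (Fin n) k).constr k fun D =>
      if h : ∃ i, edgeExp (ε i) ≤ D then
        (linearSyzygies k n ε).mkQ
          (Pi.single h.choose (monomial (D - edgeExp (ε h.choose)) 1))
      else 0
  have hφ : ∀ i (p : MvPolynomial (Fin n) k),
      φ (p * fmon k ε i) = (linearSyzygies k n ε).mkQ (Pi.single i p) := by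
    intro i p
    induction p using MvPolynomial.induction_on' with
    | add p q hp hq => rw [add_mul, map_add, hp, hq, Pi.single_add, map_add]
    | monomial u c =>
      have hex : ∃ l, edgeExp (ε l) ≤ u + edgeExp (ε i) := ⟨i, le_add_self⟩
      have hu : φ (monomial (u + edgeExp (ε i)) 1) =
          (linearSyzygies k n ε).mkQ (Pi.single i (monomial u 1)) := by
        have h := (basisMonomials (Fin n) k).constr_basis k
          (fun D => if h : ∃ i, edgeExp (ε i) ≤ D then
            (linearSyzygies k n ε).mkQ
              (Pi.single h.choose (monomial (D - edgeExp (ε h.choose)) 1))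
            else 0) (u + edgeExp (ε i))
        rw [dif_pos hex, coe_basisMonomials] at h
        refine h.trans ?_
        rw [← sub_eq_zero, ← map_sub, ← LinearMap.mem_ker, Submodule.ker_mkQ]
        simpa using sub_mem_linearSyzygies k ε hinj hdiam hex.choose i hex.choose_spec
          le_add_self
      have hc : ∀ v : Fin n →₀ ℕ, (monomial v c : MvPolynomial (Fin n) k) =
          c • monomial v 1 := fun v => by
        rw [smul_monomial, smul_eq_mul, mul_one]
      rw [fmon_eq_monomial, monomial_mul, mul_one, hc, map_smul, hu, hc, Pi.single_smul,
        LinearMap.map_smul_of_tower]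
  rw [← Submodule.ker_mkQ (linearSyzygies k n ε), LinearMap.mem_ker]
  calc (linearSyzygies k n ε).mkQ a
      = (linearSyzygies k n ε).mkQ (∑ i, Pi.single i (a i)) := by
        rw [Finset.univ_sum_single]
    _ = φ (∑ i, a i * fmon k ε i) := by simp only [map_sum, hφ]
    _ = 0 := by rw [show ∑ i, a i * fmon k ε i = 0 from ha, map_zero]

end

theorem eq_of_edgeExp_le {n : ℕ} {ι : Type*} {ε : ι → Sym2 (Fin n)}
    (hinj : Function.Injective ε) {i j l : ι} (hij : ∀ v, v ∈ ε i → v ∉ ε j)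
    (hno : ¬ ∃ l, LAdj ε i l ∧ LAdj ε l j) {u : Fin n} (hu : u ∈ ε j)
    (hl : edgeExp (ε l) ≤ edgeExp (ε i) + Finsupp.single u 1) : l = i := by
  have hui : u ∉ ε i := fun h => hij u h hu
  have hul : u ∉ ε l := by
    intro hul
    obtain ⟨q, hq⟩ := hul
    have hqu : q ≠ u := by
      rintro rfl
      have h1 := hl q
      rw [mem_iff_edgeExp_pos] at hui
      simp only [hq, edgeExp_mk, Finsupp.add_apply, Finsupp.single_apply, if_true] at h1
      omega
    have hqi : q ∈ ε i := by
      have h1 := hl q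
      rw [mem_iff_edgeExp_pos]
      simp only [hq, edgeExp_mk, Finsupp.add_apply, Finsupp.single_apply, if_true,
        if_neg hqu.symm] at h1
      omega
    have hql : q ∈ ε l := hq ▸ Sym2.mem_mk_right u q
    have hul : u ∈ ε l := hq ▸ Sym2.mem_mk_left u q
    refine hno ⟨l, ⟨?_, q, hqi, hql⟩, ⟨?_, u, hul, hu⟩⟩
    · rintro rfl
      exact hui hul
    · rintro rfl
      exact hij q hqi hql
  have hle : ∀ t, edgeExp (ε l) t ≤ edgeExp (ε i) t := by
    intro t
    have h1 := hl t
    simp only [Finsupp.add_apply, Finsupp.single_apply] at h1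
    split_ifs at h1 with h
    · subst h
      rw [mem_iff_edgeExp_pos] at hul
      omega
    · exact h1
  apply hinj
  generalize ε l = e at hle
  generalize ε i = e' at hle
  induction e with
  | _ p q =>
    induction e' with
    | _ a b =>
      have hp := hle p
      have hq := hle q
      simp only [edgeExp_mk, if_true] at hp hq
      rw [Sym2.eq_iff]
      split_ifs at hp hq <;> grind

theorem coeff_single_eq_zero {k : Type*} [Field k] {n : ℕ} {ι : Type*} [Fintype ι]
    {ε : ι → Sym2 (Fin n)} {a : ι → MvPolynomial (Fin n) k} (ha : a ∈ SyzSet k n ε) {i : ι}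
    {d : Fin n →₀ ℕ} (h : ∀ l, edgeExp (ε l) ≤ edgeExp (ε i) + d → l = i) :
    coeff d (a i) = 0 := by
  have h0 := congrArg (coeff (edgeExp (ε i) + d)) (show ∑ i, a i * fmon k ε i = 0 from ha)
  rw [coeff_sum, Finset.sum_eq_single i] at h0
  · simpa [fmon_eq_monomial, coeff_mul_monomial'] using h0
  · intro l _ hl
    rw [fmon_eq_monomial, coeff_mul_monomial', if_neg fun hle => hl (h l hle)]
  · simp

theorem diamLeTwo_of_linearlyPresented (k : Type*) [Field k] {n : ℕ} {ι : Type*} [Fintype ι]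
    {ε : ι → Sym2 (Fin n)} (hinj : Function.Injective ε) (hlin : LinearlyPresented k n ε) :
    DiamLeTwo ε := by
  classical
  intro i j
  by_contra! hcon
  obtain ⟨hne, hadj, hno⟩ := hcon
  have hdisj : ∀ v, v ∈ ε i → v ∉ ε j := fun v hv hv' => hadj ⟨hne, v, hv, hv'⟩
  have hvanish : ∀ a ∈ linearSyzygies k n ε, ∀ d ≤ edgeExp (ε j), coeff d (a i) = 0 := by
    intro a ha
    induction ha using Submodule.span_induction with
    | mem x hx =>
      intro d hd
      obtain h0 | h0 := hx.2 i
      · rw [h0, coeff_zero]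
      · by_contra hne0
        have hdeg : d.degree = 1 := by
          rw [← h0 hne0, Finsupp.degree_eq_weight_one]
          rfl
        obtain ⟨u, rfl⟩ := (Finsupp.sum_eq_one_iff d).1 hdeg
        have hu : u ∈ ε j := by
          rw [mem_iff_edgeExp_pos, Nat.pos_iff_ne_zero, ← Nat.one_le_iff_ne_zero]
          simpa using hd u
        exact hne0 (coeff_single_eq_zero hx.1 fun l hl =>
          eq_of_edgeExp_le hinj hdisj (by simpa using hno) hu hl)
    | zero => simp
    | add x y _ _ hx hy =>
      intro d hd
      rw [Pi.add_apply, coeff_add, hx d hd, hy d hd, add_zero]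
    | smul r x _ hx =>
      intro d hd
      rw [Pi.smul_apply, smul_eq_mul, coeff_mul]
      refine Finset.sum_eq_zero fun p hp => ?_
      rw [hx p.2 ((Finset.HasAntidiagonal.mem_antidiagonal.1 hp ▸ le_add_self).trans hd), mul_zero]
  have hmem : (Pi.single i (fmon k ε j) - Pi.single j (fmon k ε i) :
      ι → MvPolynomial (Fin n) k) ∈ linearSyzygies k n ε := by
    have : _ ∈ SyzSet k n ε :=
      single_sub_single_mem_SyzSet k ε (mul_comm (fmon k ε j) (fmon k ε i))
    rw [hlin] at this
    exact this
  have := hvanish _ hmem _ le_rfl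
  simp [hne, fmon_eq_monomial] at this

end PolarAlg

open PolarAlg in
/-- Lemma 5.12: for a cohesive set `f` of distinct degree-2 monomials, the ideal `I = (f)` is
linearly presented if and only if the edge graph `L(f)` of `G(f)` has diameter at most 2. -/
theorem linearly_presented_iff_diameter_le_two (k : Type*) [Field k] [CharZero k]
    {n m : ℕ} (ε : Fin m → Sym2 (Fin n)) (hinj : Function.Injective ε)
    (hcoh : ∀ u v : Fin n,
      Relation.ReflTransGen (fun a b => ∃ i, ε i = s(a, b)) u v) :
    LinearlyPresented k n ε ↔ DiamLeTwo ε := by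
  exact ⟨diamLeTwo_of_linearlyPresented k hinj, linearlyPresented_of_diamLeTwo k ε hinj⟩
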